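/- Let R be a commutative ring of prime characteristic p and M a finitely presented R-module. If R_P is a regular local ring for every prime P with M_P ≠ 0 and dim R/P ≥ 2 (in the F-finite setting), then Tor_1^R(F^e_* R, M) has support of dimension at most 1 for every e ≥ 0, where F^e_* R is R viewed as an R-module via the e-th Frobenius. -/

import Mathlib

open CategoryTheory

section WeaklyRegularPow

open RingTheory.Sequence Pointwise

universe u v
variable {R : Type u} [CommRing R]

theorem isWeaklyRegular_of_shortExact (rs : List R) : ∀ {M₁ M₂ M₃ : Type v}
    [AddCommGroup M₁] [Module R M₁] [AddCommGroup M₂] [Module R M₂]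
    [AddCommGroup M₃] [Module R M₃] {f : M₁ →ₗ[R] M₂} {g : M₂ →ₗ[R] M₃},
    Function.Injective f → Function.Exact f g → Function.Surjective g →
    IsWeaklyRegular M₁ rs → IsWeaklyRegular M₃ rs → IsWeaklyRegular M₂ rs := by
  induction rs with
  | nil => intros; exact .nil _ _
  | cons r rs ih =>
    intro M₁ M₂ M₃ _ _ _ _ _ _ f g hf hfg hg h₁ h₃
    rw [isWeaklyRegular_cons_iff] at h₁ h₃ ⊢
    refine ⟨isSMulRegular_of_range_eq_ker hf (LinearMap.exact_iff.mp hfg).symm h₁.1 h₃.1,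
      ih (f := QuotSMulTop.map r f) (g := QuotSMulTop.map r g) ?_
        (QuotSMulTop.map_exact r hfg hg) (QuotSMulTop.map_surjective r hg) h₁.2 h₃.2⟩
    have h := QuotSMulTop.map_first_exact_on_four_term_exact_of_isSMulRegular_last
      (f₁ := (0 : M₁ →ₗ[R] M₁)) (f₂ := f) (f₃ := g)
      ((LinearMap.exact_zero_iff_injective M₁ f).mpr hf) hfg h₃.1
    rw [map_zero] at h
    exact (LinearMap.exact_zero_iff_injective _ _).mp h

theorem isWeaklyRegular_of_subsingleton (M : Type v) [AddCommGroup M] [Module R M]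
    [Subsingleton M] (rs : List R) : IsWeaklyRegular M rs := by
  induction rs generalizing M with
  | nil => exact .nil _ _
  | cons r rs ih => exact .cons (Function.injective_of_subsingleton _) (ih _)

theorem isWeaklyRegular_quotSMulTop_pow {M : Type v} [AddCommGroup M] [Module R M] {x : R}
    (hx : IsSMulRegular M x) {rs : List R} (h : IsWeaklyRegular (QuotSMulTop x M) rs) (n : ℕ) :
    IsWeaklyRegular (QuotSMulTop (x ^ n) M) rs := by
  induction n with
  | zero =>
    have : Subsingleton (QuotSMulTop (x ^ 0) M) := by
      rw [pow_zero, Submodule.Quotient.subsingleton_iff, one_smul]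
    exact isWeaklyRegular_of_subsingleton _ rs
  | succ n ih =>
    let f : QuotSMulTop (x ^ n) M →ₗ[R] QuotSMulTop (x ^ (n + 1)) M :=
      Submodule.mapQ _ _ (LinearMap.lsmul R M x) (by
        intro y hy
        obtain ⟨z, -, rfl⟩ := (Submodule.mem_smul_pointwise_iff_exists _ _ _).mp hy
        exact (Submodule.mem_smul_pointwise_iff_exists _ _ _).mpr
          ⟨z, trivial, by simp [smul_smul, pow_succ]⟩)
    let g : QuotSMulTop (x ^ (n + 1)) M →ₗ[R] QuotSMulTop x M :=
      Submodule.mapQ _ _ LinearMap.id (by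
        intro y hy
        obtain ⟨z, -, rfl⟩ := (Submodule.mem_smul_pointwise_iff_exists _ _ _).mp hy
        exact (Submodule.mem_smul_pointwise_iff_exists _ _ _).mpr
          ⟨x ^ n • z, trivial, by simp [smul_smul, pow_succ']⟩)
    refine isWeaklyRegular_of_shortExact rs (f := f) (g := g) ?_ ?_ ?_ ih h
    · rw [injective_iff_map_eq_zero]
      intro y hy
      obtain ⟨y, rfl⟩ := Submodule.mkQ_surjective _ y
      obtain ⟨z, -, hz⟩ := (Submodule.mem_smul_pointwise_iff_exists _ _ _).mp
        ((Submodule.Quotient.mk_eq_zero _).mp hy)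
      refine (Submodule.Quotient.mk_eq_zero _).mpr
        ((Submodule.mem_smul_pointwise_iff_exists _ _ _).mpr ⟨z, trivial, hx ?_⟩)
      simpa [smul_smul, pow_succ'] using hz
    · intro y
      obtain ⟨y, rfl⟩ := Submodule.mkQ_surjective _ y
      constructor
      · intro hy
        obtain ⟨z, -, rfl⟩ := (Submodule.mem_smul_pointwise_iff_exists _ _ _).mp
          ((Submodule.Quotient.mk_eq_zero _).mp hy)
        exact ⟨Submodule.Quotient.mk z, rfl⟩
      · rintro ⟨z, hz⟩
        obtain ⟨z, rfl⟩ := Submodule.mkQ_surjective _ z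
        rw [← hz]
        exact (Submodule.Quotient.mk_eq_zero _).mpr
          ((Submodule.mem_smul_pointwise_iff_exists _ _ _).mpr ⟨z, trivial, rfl⟩)
    · intro y
      obtain ⟨y, rfl⟩ := Submodule.mkQ_surjective _ y
      exact ⟨Submodule.Quotient.mk y, rfl⟩

theorem RingTheory.Sequence.IsWeaklyRegular.map_pow {M : Type v} [AddCommGroup M] [Module R M]
    {rs : List R} (h : IsWeaklyRegular M rs) (n : ℕ) :
    IsWeaklyRegular M (rs.map (· ^ n)) := by
  induction rs generalizing M with
  | nil => exact .nil _ _
  | cons r rs ih =>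
    rw [isWeaklyRegular_cons_iff] at h
    exact .cons (h.1.pow n) (ih (isWeaklyRegular_quotSMulTop_pow h.1 h.2 n))

end WeaklyRegularPow

section RegularLocal

open IsLocalRing RingTheory.Sequence Pointwise

universe u v

theorem free_of_isWeaklyRegular_of_ofList_eq_maximalIdeal
    {R : Type u} [CommRing R] [IsLocalRing R] [IsNoetherianRing R] {M : Type v} [AddCommGroup M]
    [Module R M] [Module.Finite R M] (rs : List R) (hrs : Ideal.ofList rs = maximalIdeal R)
    (h : IsWeaklyRegular M rs) : Module.Free R M := by
  obtain ⟨n, hn⟩ : ∃ n, rs.length = n := ⟨_, rfl⟩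
  induction n generalizing R M with
  | zero =>
    obtain rfl := List.eq_nil_of_length_eq_zero hn
    rw [Ideal.ofList_nil, eq_comm, ← IsLocalRing.isField_iff_maximalIdeal_eq] at hrs
    let := hrs.toField
    exact Module.Free.of_divisionRing R M
  | succ n ih =>
    obtain ⟨r, rs, rfl⟩ := List.exists_cons_of_length_eq_add_one hn
    have hr : r ∈ maximalIdeal R := by
      rw [← hrs]
      exact Ideal.subset_span (by simp)
    have : Nontrivial (R ⧸ Ideal.span {r}) := Ideal.Quotient.nontrivial_iff.mpr fun h ↦
      (maximalIdeal.isMaximal R).ne_top (top_le_iff.mp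
        (h ▸ (Ideal.span_singleton_le_iff_mem _).mpr hr))
    have : IsLocalRing (R ⧸ Ideal.span {r}) := .of_surjective' _ Ideal.Quotient.mk_surjective
    have := Module.Finite.of_restrictScalars_finite R (R ⧸ Ideal.span {r}) (QuotSMulTop r M)
    rw [isWeaklyRegular_cons_iff'] at h
    have := Module.finitePresentation_of_finite R M
    refine (Module.free_quotSMulTop_iff_free R M ?_ h.1).mp (ih _ ?_ h.2 (by simpa using hn))
    · rwa [jacobson_eq_maximalIdeal _ bot_ne_top]
    · rw [← Ideal.map_ofList, ← map_maximalIdeal_of_surjective _ Ideal.Quotient.mk_surjective,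
        ← hrs, Ideal.ofList_cons, Ideal.map_sup, Ideal.map_quotient_self, bot_sup_eq]

/-- Exchange property for generators of the maximal ideal. -/
theorem exists_maximalIdeal_eq_span_singleton_sup_span_erase {A : Type u} [CommRing A]
    [IsLocalRing A] [DecidableEq A] {s : Finset A}
    (hs : Ideal.span (s : Set A) = maximalIdeal A) {x : A}
    (hx : x ∈ maximalIdeal A) (hx' : x ∉ maximalIdeal A ^ 2) :
    ∃ a ∈ s, maximalIdeal A = Ideal.span {x} ⊔ Ideal.span (s.erase a : Set A) := by
  obtain ⟨c, hc⟩ := Submodule.mem_span_finset'.mp (hs ▸ hx)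
  obtain ⟨a, ha⟩ : ∃ a : s, IsUnit (c a) := by
    by_contra! H
    refine hx' (hc ▸ sum_mem fun a _ ↦ ?_)
    rw [pow_two, smul_eq_mul]
    exact Ideal.mul_mem_mul (H a) (hs ▸ Ideal.subset_span a.2)
  refine ⟨a, a.2, le_antisymm ?_ (sup_le ((Ideal.span_singleton_le_iff_mem _).mpr hx) ?_)⟩
  · rw [← hs, Ideal.span_le]
    intro b hb
    by_cases hab : b = a
    · subst hab
      rw [SetLike.mem_coe, ← Ideal.unit_mul_mem_iff_mem _ ha]
      rw [← Finset.add_sum_erase _ _ (Finset.mem_univ a), smul_eq_mul] at hc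
      rw [eq_sub_of_add_eq hc]
      refine sub_mem (Ideal.mem_sup_left (Ideal.mem_span_singleton_self x))
        (sum_mem fun b hb ↦ Ideal.mul_mem_left _ _ (Ideal.mem_sup_right (Ideal.subset_span ?_)))
      exact Finset.mem_coe.mpr (Finset.mem_erase.mpr
        ⟨fun h ↦ Finset.ne_of_mem_erase hb (Subtype.ext h), b.2⟩)
    · exact Ideal.mem_sup_right (Ideal.subset_span (by simpa [hab] using hb))
  · rw [← hs]
    exact Ideal.span_mono (by simp)

theorem exists_mem_maximalIdeal_notMem_sq_notMem_minimalPrimes {A : Type u} [CommRing A]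
    [IsLocalRing A] [IsNoetherianRing A] (hA : ringKrullDim A ≠ 0) :
    ∃ x ∈ maximalIdeal A, x ∉ maximalIdeal A ^ 2 ∧ ∀ Q ∈ minimalPrimes A, x ∉ Q := by
  classical
  by_contra! H
  have hfin := minimalPrimes.finite_of_isNoetherianRing A
  obtain ⟨I, hI, hle⟩ := (Ideal.subset_union_prime (I := maximalIdeal A)
    (s := insert (maximalIdeal A ^ 2) hfin.toFinset)
    (f := id) (maximalIdeal A ^ 2) (maximalIdeal A ^ 2) (by
      intro i hi h _
      have : i ∈ minimalPrimes A := by simpa [h] using hi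
      exact this.1.1)).mp (by
      intro x hx
      by_cases hx2 : x ∈ maximalIdeal A ^ 2
      · simp [hx2]
      · obtain ⟨Q, hQ, hxQ⟩ := H x hx hx2
        simp only [Set.mem_iUnion]
        exact ⟨Q, by simp [hQ], hxQ⟩)
  rw [Finset.mem_insert, Set.Finite.mem_toFinset] at hI
  obtain rfl | hI := hI
  · have : maximalIdeal A = ⊥ := Submodule.eq_bot_of_le_smul_of_le_jacobson_bot
      (maximalIdeal A) _ (IsNoetherian.noetherian _) (by simpa [pow_two] using hle)
      (maximalIdeal_le_jacobson _)
    exact hA (ringKrullDim_eq_zero_of_isField (isField_iff_maximalIdeal_eq.mpr this))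
  · have : I.IsPrime := hI.1.1
    have hm : I = maximalIdeal A := le_antisymm (le_maximalIdeal this.ne_top) hle
    refine hA ?_
    rw [← maximalIdeal_height_eq_ringKrullDim, ← hm, Ideal.height_eq_zero_iff.mpr hI]
    rfl

theorem isDomain_and_exists_isWeaklyRegular (d : ℕ) : ∀ {A : Type u} [CommRing A]
    [IsLocalRing A] [IsNoetherianRing A], ringKrullDim A = d →
    (∃ s : Finset A, s.card ≤ d ∧ Ideal.span (s : Set A) = maximalIdeal A) →
    IsDomain A ∧ ∃ rs : List A, Ideal.ofList rs = maximalIdeal A ∧ IsWeaklyRegular A rs := by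
  induction d with
  | zero =>
    rintro A _ _ _ - ⟨s, hs, hm⟩
    obtain rfl : s = ∅ := by simpa using hs
    have hm : maximalIdeal A = ⊥ := by simpa using hm.symm
    exact ⟨(isField_iff_maximalIdeal_eq.mpr hm).isDomain, [], by simp [hm], .nil _ _⟩
  | succ d ih =>
    rintro A _ _ _ hd ⟨s, hs, hm⟩
    classical
    obtain ⟨x, hx, hx2, hxQ⟩ := exists_mem_maximalIdeal_notMem_sq_notMem_minimalPrimes (A := A)
      (by rw [hd]; norm_cast)
    obtain ⟨a, ha, hxa⟩ := exists_maximalIdeal_eq_span_singleton_sup_span_erase hm hx hx2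
    let B := A ⧸ Ideal.span {x}
    have : Nontrivial B := Ideal.Quotient.nontrivial_iff.mpr fun h ↦
      (maximalIdeal.isMaximal A).ne_top (top_le_iff.mp
        (h ▸ (Ideal.span_singleton_le_iff_mem _).mpr hx))
    have : IsLocalRing B := .of_surjective' _ Ideal.Quotient.mk_surjective
    have hB : Ideal.span
        (((s.erase a).image (Ideal.Quotient.mk (Ideal.span {x})) : Finset B) : Set B) =
          maximalIdeal B := by
      rw [← map_maximalIdeal_of_surjective _ Ideal.Quotient.mk_surjective, hxa, Ideal.map_sup,
        Ideal.map_quotient_self, bot_sup_eq, Ideal.map_span, Finset.coe_image]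
    have hcard : ((s.erase a).image (Ideal.Quotient.mk (Ideal.span {x}))).card ≤ d := by
      have := Finset.card_erase_of_mem ha
      exact Finset.card_image_le.trans (by omega)
    have heq : x • (⊤ : Ideal A) = Ideal.span {x} := by
      simp [← Submodule.ideal_span_singleton_smul]
    have hdim : ringKrullDim B = d := by
      apply le_antisymm
      · refine (ringKrullDim_le_spanFinrank_maximalIdeal B).trans ?_
        rw [← hB]
        have := Submodule.spanFinrank_span_le_ncard_of_finite (R := B)
          ((s.erase a).image (Ideal.Quotient.mk (Ideal.span {x}))).finite_toSet
        rw [Set.ncard_coe_finset] at this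
        exact_mod_cast this.trans hcard
      · have := ringKrullDim_le_ringKrullDim_quotSMulTop_succ hx
        rw [heq, hd, Nat.cast_succ] at this
        exact ENat.WithBot.add_le_add_one_right_iff.mp this
    obtain ⟨hdom, rs, hrs, hreg⟩ := ih hdim ⟨_, hcard, hB⟩
    have hprime : (Ideal.span {x}).IsPrime := (Ideal.Quotient.isDomain_iff_prime _).mp hdom
    obtain ⟨Q, hQ, hQx⟩ := Ideal.exists_minimalPrimes_le (bot_le (a := Ideal.span {x}))
    have hQprime : Q.IsPrime := hQ.1.1
    have hQbot : Q = ⊥ := by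
      refine Submodule.eq_bot_of_le_smul_of_le_jacobson_bot (Ideal.span {x}) _
        (IsNoetherian.noetherian _) (fun y hy ↦ ?_)
        (((Ideal.span_singleton_le_iff_mem _).mpr hx).trans (maximalIdeal_le_jacobson _))
      obtain ⟨z, rfl⟩ := Ideal.mem_span_singleton.mp (hQx hy)
      exact Submodule.smul_mem_smul (Ideal.mem_span_singleton_self x)
        ((hQprime.mem_or_mem hy).resolve_left (hxQ Q hQ))
    have hA : IsDomain A :=
      have : (⊥ : Ideal A).IsPrime := hQbot ▸ hQprime
      IsDomain.of_bot_isPrime A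
    have hx0 : x ≠ 0 := by
      rintro rfl
      exact hxQ Q hQ Q.zero_mem
    obtain ⟨rs, rfl⟩ := List.map_surjective_iff.mpr Ideal.Quotient.mk_surjective rs
    refine ⟨hA, x :: rs, ?_, ?_⟩
    · rw [← Ideal.map_ofList,
        ← map_maximalIdeal_of_surjective _ Ideal.Quotient.mk_surjective] at hrs
      have := congrArg (Ideal.comap (Ideal.Quotient.mk (Ideal.span {x}))) hrs
      rwa [Ideal.comap_map_of_surjective' _ Ideal.Quotient.mk_surjective,
        Ideal.comap_map_of_surjective' _ Ideal.Quotient.mk_surjective, Ideal.mk_ker,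
        sup_comm, ← Ideal.ofList_cons, sup_eq_left.mpr] at this
      rwa [Ideal.span_singleton_le_iff_mem]
    · rw [isWeaklyRegular_cons_iff]
      refine ⟨(IsRegular.of_ne_zero hx0).left.isSMulRegular, ?_⟩
      rw [← Ideal.Quotient.algebraMap_eq, isWeaklyRegular_map_algebraMap_iff] at hreg
      exact ((Submodule.quotEquivOfEq _ _ heq).isWeaklyRegular_congr rs).mpr hreg

/-- The flatness half of Kunz's theorem for finite Frobenius: if `N` is the regular local ring
`A` with `a • n = a ^ q * n` and `N` is finite over `A`, then `N` is flat over `A`. -/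
theorem flat_of_smul_eq_pow_mul {A : Type u} [CommRing A] [IsRegularLocalRing A] {N : Type v}
    [AddCommGroup N] [Module A N] [Module.Finite A N] (q : ℕ) (g : N ≃+ A)
    (hg : ∀ a n, g (a • n) = a ^ q * g n) : Module.Flat A N := by
  obtain ⟨s, hs, hspan⟩ :=
    (IsNoetherian.noetherian (maximalIdeal A)).exists_span_finset_card_eq_spanFinrank
  obtain ⟨-, rs, hrs, h⟩ := isDomain_and_exists_isWeaklyRegular _
    (IsRegularLocalRing.spanFinrank_maximalIdeal).symm ⟨s, hs.le, hspan⟩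
  have := free_of_isWeaklyRegular_of_ofList_eq_maximalIdeal (M := N) rs hrs <|
    (AddEquiv.isWeaklyRegular_congr (e := g) (as := rs) (bs := rs.map (· ^ q)) (by
      rw [List.forall₂_map_right_iff, List.forall₂_same]
      exact fun a _ n ↦ hg a n)).mpr (h.map_pow q)
  infer_instance

end RegularLocal

section FrobeniusPushforward

universe u

theorem isLocalizedModule_of_smul_eq_pow_mul {R A : Type*} [CommRing R] [CommRing A] [Algebra R A]
    (S : Submonoid R) [IsLocalization S A] {N N' : Type*} [AddCommGroup N] [AddCommGroup N']
    [Module R N] [Module R N'] {q : ℕ} (hq : q ≠ 0) (g : N ≃+ R)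
    (hg : ∀ r n, g (r • n) = r ^ q * g n)
    (g' : N' ≃+ A) (hg' : ∀ (r : R) n, g' (r • n) = algebraMap R A r ^ q * g' n)
    (f : N →ₗ[R] N') (hf : ∀ n, g' (f n) = algebraMap R A (g n)) :
    IsLocalizedModule S f where
  map_units s := by
    have hu : IsUnit (algebraMap R A s ^ q) := (IsLocalization.map_units A s).pow q
    rw [Module.End.isUnit_iff]
    refine ⟨fun x y h ↦ ?_, fun y ↦ ?_⟩
    · apply g'.injective
      apply hu.mul_left_cancel
      rw [← hg', ← hg']
      exact congrArg g' h
    · refine ⟨g'.symm (↑hu.unit⁻¹ * g' y), g'.injective ?_⟩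
      rw [Module.algebraMap_end_apply, hg', g'.apply_symm_apply, ← mul_assoc,
        IsUnit.mul_val_inv, one_mul]
  surj y := by
    obtain ⟨⟨r, s⟩, h⟩ := IsLocalization.surj S (g' y)
    refine ⟨⟨g.symm (r * s ^ (q - 1)), s⟩, g'.injective ?_⟩
    dsimp only at h ⊢
    rw [Submonoid.smul_def, hg', hf, g.apply_symm_apply, map_mul, ← h, map_pow, mul_assoc,
      mul_pow_sub_one hq, mul_comm]
  exists_of_eq {x y} h := by
    replace h := congrArg g' h
    rw [hf, hf] at h
    obtain ⟨c, hc⟩ := IsLocalization.exists_of_eq (M := S) h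
    refine ⟨c, g.injective ?_⟩
    rw [Submonoid.smul_def, Submonoid.smul_def, hg, hg, ← pow_sub_one_mul hq, mul_assoc, hc,
      mul_assoc]

/-- `A` viewed as an `R`-module along a ring homomorphism `R → A`. -/
def RestrictedAlong {R A : Type u} [CommRing R] [CommRing A] (_ : R →+* A) : Type u := A

namespace RestrictedAlong

variable {R A : Type u} [CommRing R] [CommRing A] (φ : R →+* A)

instance : AddCommGroup (RestrictedAlong φ) := inferInstanceAs (AddCommGroup A)

instance : Module R (RestrictedAlong φ) := Module.compHom A φ

/-- The identity map. -/
def addEquiv : RestrictedAlong φ ≃+ A := AddEquiv.refl A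

theorem addEquiv_smul (r : R) (x : RestrictedAlong φ) :
    addEquiv φ (r • x) = φ r * addEquiv φ x := rfl

end RestrictedAlong

theorem exists_isLocalizedModule_flat {R : Type u} [CommRing R] [IsNoetherianRing R]
    (p e : ℕ) [Fact p.Prime] [CharP R p]
    [Module.Finite R (RestrictedAlong (iterateFrobenius R p e))] (P : Ideal R) [P.IsPrime]
    [IsRegularLocalRing (Localization.AtPrime P)] :
    ∃ (N : Type u) (_ : AddCommGroup N) (_ : Module R N)
      (f : RestrictedAlong (iterateFrobenius R p e) →ₗ[R] N),
      IsLocalizedModule P.primeCompl f ∧ Module.Flat R N := by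
  let A := Localization.AtPrime P
  have : CharP A p := (CharP.charP_iff_prime_eq_zero Fact.out).mpr <| by
    rw [← map_natCast (algebraMap R A), CharP.cast_eq_zero, map_zero]
  let N := RestrictedAlong (iterateFrobenius A p e)
  let : Module R N := Module.compHom N (algebraMap R A)
  have : IsScalarTower R A N := .of_algebraMap_smul fun _ _ ↦ rfl
  let g := RestrictedAlong.addEquiv (iterateFrobenius R p e)
  let g' := RestrictedAlong.addEquiv (iterateFrobenius A p e)
  have hg' (r : R) (n : N) : g' (r • n) = algebraMap R A r ^ p ^ e * g' n := by
    rw [← algebraMap_smul A, RestrictedAlong.addEquiv_smul, iterateFrobenius_def]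
  let f : RestrictedAlong (iterateFrobenius R p e) →ₗ[R] N :=
    { toFun := fun x ↦ g'.symm (algebraMap R A (g x))
      map_add' := fun x y ↦ by simp
      map_smul' := fun r x ↦ g'.injective <| by
        simp [g, hg', RestrictedAlong.addEquiv_smul, iterateFrobenius_def] }
  have hloc : IsLocalizedModule P.primeCompl f :=
    isLocalizedModule_of_smul_eq_pow_mul (A := A) P.primeCompl
      (pow_ne_zero e (Fact.out : p.Prime).ne_zero) g
      (fun r n ↦ by rw [RestrictedAlong.addEquiv_smul, iterateFrobenius_def]) g' hg' f
      (fun n ↦ g'.apply_symm_apply _)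
  have : Module.Finite A N := Module.Finite.of_isLocalizedModule P.primeCompl f
  have : Module.Flat A N := flat_of_smul_eq_pow_mul (p ^ e) g' fun a n ↦ by
    rw [RestrictedAlong.addEquiv_smul, iterateFrobenius_def]
  have : Module.Flat R A := IsLocalization.flat A P.primeCompl
  exact ⟨N, inferInstance, inferInstance, f, hloc, Module.Flat.trans R A N⟩

end FrobeniusPushforward

section Tor

open MonoidalCategory

universe u

variable {R : Type u} [CommRing R]

theorem CategoryTheory.ShortComplex.exists_cycle_of_homology
    (K : ShortComplex (ModuleCat.{u} R)) (x : K.homology) :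
    ∃ z : K.X₂, K.g z = 0 ∧ ∀ (r : R) (y : K.X₁), K.f y = r • z → r • x = 0 := by
  obtain ⟨w, rfl⟩ := (ModuleCat.epi_iff_surjective K.homologyπ).mp inferInstance x
  refine ⟨K.iCycles w, by simp [← ModuleCat.comp_apply], fun r y hy ↦ ?_⟩
  have hw : K.toCycles y = r • w := by
    apply (ModuleCat.mono_iff_injective K.iCycles).mp inferInstance
    rw [map_smul, ← hy, ← ModuleCat.comp_apply, K.toCycles_i]
  rw [← map_smul, ← hw, ← ModuleCat.comp_apply, K.toCycles_comp_homologyπ]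
  rfl

theorem CategoryTheory.ProjectiveResolution.exists_cycle_of_tor {N M : ModuleCat.{u} R}
    (Q : ProjectiveResolution M) (x : ((Tor (ModuleCat R) 1).obj N).obj M) :
    ∃ z : (N ⊗ Q.complex.X 1 : ModuleCat R), (N ◁ Q.complex.d 1 0) z = 0 ∧
      ∀ (r : R) (y : (N ⊗ Q.complex.X 2 : ModuleCat R)),
        (N ◁ Q.complex.d 2 1) y = r • z → r • x = 0 := by
  let F := (tensoringLeft (ModuleCat R)).obj N
  let L := (F.mapHomologicalComplex (ComplexShape.down ℕ)).obj Q.complex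
  let e := Q.isoLeftDerivedObj F 1 ≪≫
    ShortComplex.homologyMapIso (L.isoSc' 2 1 0 (by simp) (by simp))
  obtain ⟨z, hz, h⟩ := ShortComplex.exists_cycle_of_homology (L.sc' 2 1 0) (e.hom x)
  refine ⟨z, hz, fun r y hy ↦ ?_⟩
  have := h r y hy
  exact (ModuleCat.mono_iff_injective e.hom).mp inferInstance
    ((map_smul e.hom.hom r x).trans (this.trans (map_zero e.hom.hom).symm))

theorem smul_tor_eq_zero {N M : ModuleCat.{u} R} {r : R} (hr : ∀ m : M, r • m = 0)
    (x : ((Tor (ModuleCat R) 1).obj N).obj M) : r • x = 0 := by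
  let Q := projectiveResolution M
  obtain ⟨z, hz, h⟩ := Q.exists_cycle_of_tor x
  have comm : (r • 𝟙 Q.complex) ≫ Q.π = 0 := by
    ext w
    simp only [Linear.smul_comp, Category.id_comp]
    exact hr (Q.π.f 0 w)
  have h1 := ProjectiveResolution.liftHomotopyZeroOne_comp _ comm
  refine h r ((N ◁ ProjectiveResolution.liftHomotopyZeroOne _ comm) z) ?_
  rw [← ModuleCat.comp_apply, ← whiskerLeft_comp, h1]
  have : (N ◁ (Q.complex.d 1 0 ≫ ProjectiveResolution.liftHomotopyZeroZero _ comm)) z = 0 := by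
    rw [whiskerLeft_comp, ModuleCat.comp_apply, hz, map_zero]
  rw [← sub_zero (r • z), ← this, HomologicalComplex.smul_f_apply, HomologicalComplex.id_f]
  change (r • LinearMap.id - (Q.complex.d 1 0 ≫
    ProjectiveResolution.liftHomotopyZeroZero _ comm).hom).lTensor N z = _
  rw [LinearMap.lTensor_sub, LinearMap.lTensor_smul, LinearMap.lTensor_id]
  rfl

theorem support_tor_subset (N M : ModuleCat.{u} R) [Module.Finite R M] :
    Module.support R (((Tor (ModuleCat R) 1).obj N).obj M) ⊆ Module.support R M := by
  intro P hP
  rw [Module.mem_support_iff_of_finite]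
  intro r hr
  by_contra hrP
  exact Module.notMem_support_iff'.mpr (fun x ↦ ⟨r, hrP,
    smul_tor_eq_zero (Module.mem_annihilator.mp hr) x⟩) hP

theorem notMem_support_tor_of_flat {N M : ModuleCat.{u} R} (P : PrimeSpectrum R)
    {N' : Type u} [AddCommGroup N'] [Module R N'] (f : N →ₗ[R] N')
    [IsLocalizedModule P.asIdeal.primeCompl f] [Module.Flat R N'] :
    P ∉ Module.support R (((Tor (ModuleCat R) 1).obj N).obj M) := by
  rw [Module.notMem_support_iff']
  intro x
  let Q := projectiveResolution M
  obtain ⟨z, hz, h⟩ := Q.exists_cycle_of_tor x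
  let d₂ := (Q.complex.d 2 1).hom
  let d₁ := (Q.complex.d 1 0).hom
  have hex : Function.Exact d₂ d₁ :=
    (ShortComplex.ShortExact.moduleCat_exact_iff_function_exact _).mp (Q.exact_succ 0)
  have (X : ModuleCat.{u} R) : IsLocalizedModule P.asIdeal.primeCompl (f.rTensor X) :=
    IsLocalizedModule.rTensor R P.asIdeal.primeCompl f
  change d₁.lTensor N z = 0 at hz
  have hcomm {X Y : ModuleCat.{u} R} (d : X →ₗ[R] Y) (w) :
      f.rTensor Y (d.lTensor N w) = d.lTensor N' (f.rTensor X w) := by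
    rw [← LinearMap.comp_apply, ← LinearMap.comp_apply, LinearMap.rTensor_comp_lTensor,
      LinearMap.lTensor_comp_rTensor]
  obtain ⟨y, hy⟩ := ((Module.Flat.lTensor_exact N' hex) (f.rTensor _ z)).mp (by
    rw [← hcomm, hz, map_zero])
  obtain ⟨⟨y', s⟩, hs⟩ :=
    IsLocalizedModule.surj P.asIdeal.primeCompl (f.rTensor (Q.complex.X 2)) y
  have : f.rTensor (Q.complex.X 1) (d₂.lTensor N y') = f.rTensor (Q.complex.X 1) (s • z) := by
    rw [hcomm, ← hs, Submonoid.smul_def, map_smul, hy, Submonoid.smul_def, map_smul]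
  obtain ⟨t, ht⟩ := IsLocalizedModule.exists_of_eq (S := P.asIdeal.primeCompl) this
  refine ⟨t * s, (t * s).2, h _ (t • y') ?_⟩
  change d₂.lTensor N _ = _
  rw [Submonoid.smul_def, map_smul, mul_smul]
  exact ht

end Tor

/-- Let `R` be an `F`-finite Noetherian ring of prime characteristic `p` and `M` a finitely
presented `R`-module.  If `R_P` is a regular local ring for every prime `P` with `M_P ≠ 0`
and `dim R/P ≥ 2`, then for every `e ≥ 0` the support of `Tor_1^R(F^e_* R, M)` has
dimension at most `1`, where `F^e_* R` is `R` viewed as an `R`-module via the `e`-th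
Frobenius (`r • a = r^{p^e} a`).  Regularity of the Noetherian local ring `R_P` is
expressed as `dim R_P = dim_{κ(P)} m_P/m_P²`. -/
theorem stmt_10 (R : Type) [CommRing R] [IsNoetherianRing R] (p : ℕ) [Fact p.Prime]
    [CharP R p]
    -- `R` is `F`-finite
    (hFfinite : ∀ e : ℕ, @Module.Finite R R _ _ (Module.compHom R (iterateFrobenius R p e)))
    (M : Type) [AddCommGroup M] [Module R M] [Module.FinitePresentation R M]
    (hreg : ∀ P : PrimeSpectrum R, P ∈ Module.support R M →
      2 ≤ ringKrullDim (R ⧸ P.asIdeal) →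
      ringKrullDim (Localization.AtPrime P.asIdeal) =
        (Module.finrank (IsLocalRing.ResidueField (Localization.AtPrime P.asIdeal))
          (IsLocalRing.CotangentSpace (Localization.AtPrime P.asIdeal)) : ℕ)) :
    ∀ e : ℕ, ∀ P : PrimeSpectrum R,
      P ∈ Module.support R
        (((Tor (ModuleCat R) 1).obj
            (@ModuleCat.of R _ R _ (Module.compHom R (iterateFrobenius R p e)))).obj
          (ModuleCat.of R M)) →
      ringKrullDim (R ⧸ P.asIdeal) ≤ 1 := by
  intro e P hP
  by_contra! hdim
  have hPM : P ∈ Module.support R M := support_tor_subset _ (ModuleCat.of R M) hP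
  have : IsRegularLocalRing (Localization.AtPrime P.asIdeal) :=
    (IsRegularLocalRing.iff_finrank_cotangentSpace _).mpr
      (hreg P hPM (by
        rw [← one_add_one_eq_two]
        exact ENat.WithBot.add_one_le_iff.mpr hdim)).symm
  have : Module.Finite R (RestrictedAlong (iterateFrobenius R p e)) := hFfinite e
  obtain ⟨N, _, _, f, _, _⟩ := exists_isLocalizedModule_flat p e P.asIdeal
  exact notMem_support_tor_of_flat
    (N := ModuleCat.of R (RestrictedAlong (iterateFrobenius R p e))) P f hP
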